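/- arXiv:1505.06036 — 2 statements merged into one kernel-verified Lean document; each statement's English description precedes it below -/
import Mathlib

section
/- Let T be a finite tree rooted at an internal vertex r′, whose leaves are enumerated without repetition as b_0, …, b_{k−1} (k ≥ 3). Assume: (i) for every internal vertex u there exist indices 0 ≤ s ≤ t ≤ k−1 with L^{r′}(u) = {b_j : s ≤ j ≤ t}; (ii) every vertex w ∉ {b_0, r′} on the path in T from b_0 to r′, and every vertex w ∉ {b_1, r′} on the path in T from b_1 to r′, satisfies |L^{r′}(w)| = 1. Let G be the graph on V(T) whose edge set is E(T) together with the edges b_i b_{(i+1) mod k} for 0 ≤ i ≤ k−1. Then there exists an assignment of an L-shape ℒ_u to each vertex u ∈ V(G) such that for all distinct u, v ∈ V(G): ℒ_u ∩ ℒ_v ≠ ∅ if and only if uv ∈ E(G). -/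
open SimpleGraph Set Function

/-- `u` is an ancestor of `v` with respect to root `r`:
`u` lies on the unique path in `T` from `r` to `v`. -/
def IsAncestor {V : Type*} (T : SimpleGraph V) (r u v : V) : Prop :=
  ∀ p : T.Walk r v, p.IsPath → u ∈ p.support

/-- `u` is the parent of `v` with respect to root `r`. -/
def IsParent {V : Type*} (T : SimpleGraph V) (r u v : V) : Prop :=
  IsAncestor T r u v ∧ u ≠ v ∧ T.Adj u v

/-- `L^r(u)`: the set of leaves of `T` that are descendants of `u`. -/
def LeafSet {V : Type*} (T : SimpleGraph V) [Fintype V] [DecidableRel T.Adj] (r u : V) :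
    Set V :=
  {c | T.degree c = 1 ∧ IsAncestor T r u c}

/-- The leaf `c_{j mod k}` index. -/
def cidx {k : ℕ} (hk : 0 < k) (j : ℕ) : Fin k := ⟨j % k, Nat.mod_lt _ hk⟩

/-- A set `A` of leaves is cyclically consecutive with respect to the enumeration `c`. -/
def CycConsec {V : Type*} {k : ℕ} (hk : 0 < k) (c : Fin k → V) (A : Set V) : Prop :=
  ∃ j m : ℕ, A = {x | ∃ t ≤ m, x = c (cidx hk (j + t))}

/-- The L-shape `ℒ([x₁,x₂],[y₁,y₂]) ⊆ ℝ²`. -/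
def LShape (x1 x2 y1 y2 : ℝ) : Set (ℝ × ℝ) :=
  {p | p.1 = x1 ∧ y1 ≤ p.2 ∧ p.2 ≤ y2} ∪ {p | p.2 = y1 ∧ x1 ≤ p.1 ∧ p.1 ≤ x2}

/-- Two L-shapes meet exactly when the vertical segment of one crosses the horizontal segment
of the other. -/
lemma LShape_inter_nonempty_iff {a₁ b₁ c₁ d₁ a₂ b₂ c₂ d₂ : ℝ} (h₁ : a₁ ≤ b₁) (h₁' : c₁ ≤ d₁)
    (h₂ : a₂ ≤ b₂) (h₂' : c₂ ≤ d₂) :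
    (LShape a₁ b₁ c₁ d₁ ∩ LShape a₂ b₂ c₂ d₂).Nonempty ↔
      (a₂ ≤ a₁ ∧ a₁ ≤ b₂ ∧ c₁ ≤ c₂ ∧ c₂ ≤ d₁) ∨ (a₁ ≤ a₂ ∧ a₂ ≤ b₁ ∧ c₂ ≤ c₁ ∧ c₁ ≤ d₂) := by
  constructor
  · rintro ⟨⟨x, y⟩, h, h'⟩
    simp only [LShape, mem_union, mem_ofPred_eq] at h h'
    grind
  · rintro (h | h)
    · exact ⟨(a₁, c₂), Or.inl ⟨rfl, h.2.2⟩, Or.inr ⟨rfl, h.1, h.2.1⟩⟩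
    · exact ⟨(a₂, c₁), Or.inr ⟨rfl, h.1, h.2.1⟩, Or.inl ⟨rfl, h.2.2⟩⟩

section RootedTree

variable {V : Type*} {T : SimpleGraph V} {r u v c : V}

lemma SimpleGraph.IsTree.isPath_length_eq_dist (hT : T.IsTree) {p : T.Walk u v} (hp : p.IsPath) :
    p.length = T.dist u v := by
  obtain ⟨q, hq, hql⟩ := hT.connected.exists_path_of_dist u v
  rw [← hql, (hT.existsUnique_path u v).unique hp hq]

lemma isAncestor_self : IsAncestor T r v v := fun p _ ↦ p.end_mem_support

lemma isAncestor_root : IsAncestor T r r v := fun p _ ↦ p.start_mem_support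

lemma SimpleGraph.IsTree.dist_getVert (hT : T.IsTree) {p : T.Walk r v} (hp : p.IsPath) {n : ℕ}
    (hn : n ≤ p.length) : T.dist r (p.getVert n) = n := by
  rw [← hT.isPath_length_eq_dist (hp.take n), Walk.take_length, min_eq_left hn]

lemma IsAncestor.exists_path (hT : T.IsTree) (h : IsAncestor T r u c) :
    ∃ p : T.Walk r c, p.IsPath ∧ p.length = T.dist r c ∧ T.dist r u ≤ p.length ∧
      p.getVert (T.dist r u) = u := by
  obtain ⟨p, hp, hl⟩ := hT.connected.exists_path_of_dist r c
  obtain ⟨n, hn, hnl⟩ := Walk.mem_support_iff_exists_getVert.mp (h p hp)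
  have hd : T.dist r u = n := hn ▸ hT.dist_getVert hp hnl
  exact ⟨p, hp, hl, hd ▸ hnl, hd ▸ hn⟩

lemma IsAncestor.dist_le (hT : T.IsTree) (h : IsAncestor T r u c) : T.dist r u ≤ T.dist r c := by
  obtain ⟨p, -, hl, hu, -⟩ := h.exists_path hT
  omega

lemma IsAncestor.getVert_eq (hT : T.IsTree) (h : IsAncestor T r u c) {p : T.Walk r c}
    (hp : p.IsPath) : p.getVert (T.dist r u) = u := by
  obtain ⟨_, hq, -, -, hqu⟩ := h.exists_path hT
  rwa [(hT.existsUnique_path r c).unique hp hq]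

lemma IsAncestor.eq_of_dist_eq (hT : T.IsTree) (hu : IsAncestor T r u c)
    (hv : IsAncestor T r v c) (h : T.dist r u = T.dist r v) : u = v := by
  obtain ⟨p, hp, -, -, hpu⟩ := hu.exists_path hT
  rw [← hpu, h, hv.getVert_eq hT hp]

lemma IsAncestor.adj_of_dist_eq (hT : T.IsTree) (hu : IsAncestor T r u c)
    (hv : IsAncestor T r v c) (h : T.dist r v = T.dist r u + 1) : T.Adj u v := by
  obtain ⟨p, hp, -, hl, hpv⟩ := hv.exists_path hT
  have := p.adj_getVert_succ (i := T.dist r u) (by omega)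
  rwa [← h, hpv, hu.getVert_eq hT hp] at this

lemma IsAncestor.of_adj (hT : T.IsTree) (hadj : T.Adj u v) (h : T.dist r v = T.dist r u + 1)
    (hv : IsAncestor T r v c) : IsAncestor T r u c := by
  classical
  intro p hp
  obtain ⟨q, -, hql⟩ := hT.connected.exists_path_of_dist r u
  have hq' : (q.concat hadj).IsPath :=
    Walk.isPath_of_length_eq_dist _ (by rw [Walk.length_concat, hql, h])
  have hvp := hv p hp
  apply p.support_takeUntil_subset_support hvp
  rw [(hT.existsUnique_path r v).unique (hp.takeUntil hvp) hq', Walk.support_concat]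
  simp

lemma IsAncestor.eq_of_degree_eq_one (hT : T.IsTree) [Fintype (T.neighborSet u)]
    (hdeg : T.degree u = 1) (hur : u ≠ r) (h : IsAncestor T r u c) : u = c := by
  by_contra hne
  obtain ⟨p, hp, hl, hul, hpu⟩ := h.exists_path hT
  have hpos : 0 < T.dist r u := hT.connected.pos_dist_of_ne hur.symm
  have hlt : T.dist r u < p.length := by
    refine lt_of_le_of_ne hul fun he ↦ hne ?_
    rw [← hpu, he, Walk.getVert_length]
  have h₁ := p.adj_getVert_succ hlt
  have h₂ := p.adj_getVert_succ (i := T.dist r u - 1) (by omega)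
  rw [Nat.sub_add_cancel hpos] at h₂
  rw [hpu] at h₁ h₂
  obtain ⟨w, -, hw⟩ := (degree_eq_one_iff_existsUnique_adj).mp hdeg
  have he := (hw _ h₁).trans (hw _ h₂.symm).symm
  have h₃ := hT.dist_getVert hp (n := T.dist r u + 1) (by omega)
  have h₄ := hT.dist_getVert hp (n := T.dist r u - 1) (by omega)
  rw [he] at h₃
  omega

end RootedTree

/-- The horizontal position of the `n`-th leaf: the first two leaves are exchanged. -/
def leafPos (n : ℕ) : ℕ := if n = 0 then 1 else if n = 1 then 0 else n

lemma leafPos_leafPos (n : ℕ) : leafPos (leafPos n) = n := by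
  grind [leafPos]

lemma leafPos_lt {n k : ℕ} (hk : 3 ≤ k) (h : n < k) : leafPos n < k := by
  unfold leafPos; split_ifs <;> omega

/-- The horizontal extent, to the right, of the leaf at position `p`. -/
def leafReach (k p : ℕ) : ℕ :=
  if p = 0 then 2 else if p = 1 then k - 1 else if p + 1 = k then p else p + 1

/-- How far below all internal vertices the corner of the leaf at position `p` lies. -/
def leafDrop (k p : ℕ) : ℕ :=
  if p = 1 then k else if p + 1 = k then k else p

section LeafEnumeration

variable {V : Type*} {T : SimpleGraph V} {k : ℕ} {b : Fin k → V} {r u : V}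

/-- A vertex below which only the leaf `b i` lies occupies the single position of that leaf. -/
lemma exists_leafPos_interval_of_unique (hk : 3 ≤ k) {i : Fin k}
    (h : ∀ j, IsAncestor T r u (b j) ↔ j = i) :
    ∃ s t : ℕ, s ≤ t ∧ t < k ∧
      ∀ j : Fin k, IsAncestor T r u (b j) ↔ s ≤ leafPos j ∧ leafPos j ≤ t := by
  refine ⟨leafPos i, leafPos i, le_rfl, leafPos_lt hk i.2, fun j ↦ ?_⟩
  rw [h, ← le_antisymm_iff, Fin.ext_iff]
  exact ⟨fun hj ↦ by rw [hj], fun hj ↦ by rw [← leafPos_leafPos j, ← hj, leafPos_leafPos]⟩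

/-- If no vertex other than the root lies above the leaf `b 0` or the leaf `b 1` together with
another leaf, then exchanging these two leaves keeps the leaves below every vertex consecutive. -/
lemma exists_leafPos_interval [Fintype V] [DecidableRel T.Adj] (hT : T.IsTree) (hk : 3 ≤ k)
    (hinj : Injective b) (hleaf : ∀ v : V, T.degree v = 1 ↔ ∃ i : Fin k, v = b i)
    (hr : 2 ≤ T.degree r)
    (hconsec : ∀ u : V, 2 ≤ T.degree u → ∃ s t : Fin k, s ≤ t ∧
        LeafSet T r u = {x | ∃ j : Fin k, s ≤ j ∧ j ≤ t ∧ x = b j})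
    (hpath : ∀ i : Fin k, (i : ℕ) ≤ 1 → ∀ p : T.Walk (b i) r, p.IsPath →
        ∀ w ∈ p.support, w ≠ b i → w ≠ r → ∃ z : V, LeafSet T r w = {z}) (u : V) :
    ∃ s t : ℕ, s ≤ t ∧ t < k ∧
      ∀ i : Fin k, IsAncestor T r u (b i) ↔ s ≤ leafPos i ∧ leafPos i ≤ t := by
  have hdeg (i : Fin k) : T.degree (b i) = 1 := (hleaf _).2 ⟨i, rfl⟩
  have hmem (w : V) (i : Fin k) : b i ∈ LeafSet T r w ↔ IsAncestor T r w (b i) :=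
    ⟨fun h ↦ h.2, fun h ↦ ⟨hdeg i, h⟩⟩
  by_cases hur : u = r
  · subst hur
    refine ⟨0, k - 1, by omega, by omega, fun i ↦ ?_⟩
    have := leafPos_lt hk i.2
    simp only [isAncestor_root, true_iff]
    omega
  by_cases hu1 : T.degree u = 1
  · obtain ⟨i, rfl⟩ := (hleaf u).1 hu1
    refine exists_leafPos_interval_of_unique hk (i := i) fun j ↦ ⟨fun h ↦ ?_, ?_⟩
    · exact (hinj (h.eq_of_degree_eq_one hT hu1 hur)).symm
    · rintro rfl
      exact isAncestor_self
  by_cases hsmall : ∃ i : Fin k, (i : ℕ) ≤ 1 ∧ IsAncestor T r u (b i)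
  · obtain ⟨i, hi, hui⟩ := hsmall
    obtain ⟨p, hp, -⟩ := hT.connected.exists_path_of_dist (b i) r
    obtain ⟨z, hz⟩ := hpath i hi p hp u
      (by simpa using hui p.reverse hp.reverse) (by rintro rfl; exact hu1 (hdeg i)) hur
    have hiz : b i = z := by simpa [hz] using (hmem u i).2 hui
    refine exists_leafPos_interval_of_unique hk (i := i) fun j ↦ ?_
    rw [← hmem, hz, mem_singleton_iff, ← hiz, hinj.eq_iff]
  · have hu2 : 2 ≤ T.degree u := by
      have : Nontrivial V := ⟨u, r, hur⟩
      have := hT.connected.preconnected.degree_pos_of_nontrivial u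
      omega
    obtain ⟨s, t, hst, hL⟩ := hconsec u hu2
    have hanc (j : Fin k) : IsAncestor T r u (b j) ↔ s ≤ j ∧ j ≤ t := by
      rw [← hmem, hL]
      constructor
      · rintro ⟨i, hi, hi', he⟩
        rw [hinj he]
        exact ⟨hi, hi'⟩
      · exact fun h ↦ ⟨j, h.1, h.2, rfl⟩
    have hs : 2 ≤ (s : ℕ) := by
      by_contra hs
      exact hsmall ⟨s, by omega, (hanc s).2 ⟨le_rfl, hst⟩⟩
    refine ⟨s, t, hst, t.2, fun j ↦ ?_⟩
    rw [hanc, Fin.le_def, Fin.le_def]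
    unfold leafPos
    split_ifs <;> omega

end LeafEnumeration

lemma leaf_coordinates {k i : ℕ} (hk : 3 ≤ k) (hi : i < k) :
    (i = 0 ∧ leafPos i = 1 ∧ leafReach k (leafPos i) = k - 1 ∧ leafDrop k (leafPos i) = k) ∨
    (i = 1 ∧ leafPos i = 0 ∧ leafReach k (leafPos i) = 2 ∧ leafDrop k (leafPos i) = 0) ∨
    (2 ≤ i ∧ i + 1 < k ∧ leafPos i = i ∧ leafReach k (leafPos i) = i + 1 ∧
      leafDrop k (leafPos i) = i) ∨
    (2 ≤ i ∧ i + 1 = k ∧ leafPos i = i ∧ leafReach k (leafPos i) = i ∧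
      leafDrop k (leafPos i) = k) := by
  grind (splits := 20) [leafPos, leafReach, leafDrop]

/-- The L-shapes of two leaves cross exactly when the leaves are cyclically consecutive. -/
lemma leaf_cross_iff {k i j : ℕ} (hk : 3 ≤ k) (hi : i < k) (hj : j < k) (hij : i ≠ j) :
    (leafPos j ≤ leafPos i ∧ leafPos i ≤ leafReach k (leafPos j) ∧
        leafDrop k (leafPos j) ≤ leafDrop k (leafPos i)) ∨
      (leafPos i ≤ leafPos j ∧ leafPos j ≤ leafReach k (leafPos i) ∧
        leafDrop k (leafPos i) ≤ leafDrop k (leafPos j)) ↔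
      j = (i + 1) % k ∨ i = (j + 1) % k := by
  have hmod (n : ℕ) (hn : n < k) :
      (n + 1 = k ∧ (n + 1) % k = 0) ∨ (n + 1 < k ∧ (n + 1) % k = n + 1) := by
    rcases (Nat.succ_le_of_lt hn).eq_or_lt with h | h
    · exact Or.inl ⟨h, by rw [← Nat.succ_eq_add_one, h, Nat.mod_self]⟩
    · exact Or.inr ⟨h, Nat.mod_eq_of_lt h⟩
  have hi' := leaf_coordinates hk hi
  have hj' := leaf_coordinates hk hj
  have hmi := hmod i hi
  have hmj := hmod j hj
  generalize (i + 1) % k = mi at *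
  generalize (j + 1) % k = mj at *
  omega

/-- Under the stated hypotheses on the tree `T` rooted at `r′` with leaves
`b_0, …, b_{k−1}`, the graph `G` obtained from `T` by adding the leaf cycle has an
L-VPG representation. -/
theorem stmt5 {V : Type*} [Fintype V] (T : SimpleGraph V) [DecidableRel T.Adj]
    (hT : T.IsTree) {k : ℕ} (hk : 3 ≤ k) (b : Fin k → V)
    (hinj : Function.Injective b)
    (hleaf : ∀ v : V, T.degree v = 1 ↔ ∃ i : Fin k, v = b i)
    (r' : V) (hr' : 2 ≤ T.degree r')
    (hconsec : ∀ u : V, 2 ≤ T.degree u → ∃ s t : Fin k, s ≤ t ∧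
        LeafSet T r' u = {x | ∃ j : Fin k, s ≤ j ∧ j ≤ t ∧ x = b j})
    (hpath0 : ∀ p : T.Walk (b ⟨0, by omega⟩) r', p.IsPath →
        ∀ w ∈ p.support, w ≠ b ⟨0, by omega⟩ → w ≠ r' → ∃ z : V, LeafSet T r' w = {z})
    (hpath1 : ∀ p : T.Walk (b ⟨1, by omega⟩) r', p.IsPath →
        ∀ w ∈ p.support, w ≠ b ⟨1, by omega⟩ → w ≠ r' → ∃ z : V, LeafSet T r' w = {z}) :
    ∃ x1 x2 y1 y2 : V → ℝ,
      (∀ u : V, x1 u ≤ x2 u ∧ y1 u ≤ y2 u) ∧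
      ∀ u v : V, u ≠ v →
        ((LShape (x1 u) (x2 u) (y1 u) (y2 u) ∩
            LShape (x1 v) (x2 v) (y1 v) (y2 v)).Nonempty ↔
          (T.Adj u v ∨ ∃ i : Fin k,
            (u = b i ∧ v = b (cidx (by omega) ((i : ℕ) + 1))) ∨
            (v = b i ∧ u = b (cidx (by omega) ((i : ℕ) + 1))))) := by
  obtain ⟨D, hD⟩ : ∃ D, ∀ u, T.dist r' u ≤ D := by
    obtain ⟨D, hD⟩ := (Set.finite_range (T.dist r')).bddAbove
    exact ⟨D, fun u ↦ hD ⟨u, rfl⟩⟩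
  have hdeg (i : Fin k) : T.degree (b i) = 1 := (hleaf _).2 ⟨i, rfl⟩
  have hroot (i : Fin k) : b i ≠ r' := by
    rintro rfl
    have := hdeg i
    omega
  have hpath (i : Fin k) (hi : (i : ℕ) ≤ 1) : ∀ p : T.Walk (b i) r', p.IsPath →
      ∀ w ∈ p.support, w ≠ b i → w ≠ r' → ∃ z : V, LeafSet T r' w = {z} := by
    obtain ⟨_ | _ | n, hn⟩ := i
    · exact hpath0
    · exact hpath1
    · simp at hi
  choose s t hst htk hspec using
    exists_leafPos_interval hT hk hinj hleaf hr' hconsec hpath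
  have hbelow (u : V) (n : ℕ) (h₁ : s u ≤ n) (h₂ : n ≤ t u) :
      ∃ i : Fin k, leafPos i = n ∧ IsAncestor T r' u (b i) := by
    have hn : leafPos (leafPos n) = n := leafPos_leafPos n
    exact ⟨⟨leafPos n, leafPos_lt hk (h₂.trans_lt (htk u))⟩, hn, (hspec u _).2 (by simp [*])⟩
  have hbs (i : Fin k) : s (b i) = leafPos i := by
    obtain ⟨j, hj, hij⟩ := hbelow (b i) _ le_rfl (hst _)
    rw [← hj, hinj (hij.eq_of_degree_eq_one hT (hdeg i) (hroot i))]
  have hadj_leaf (i : Fin k) (u : V) (h : T.Adj u (b i)) :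
      T.dist r' (b i) = T.dist r' u + 1 := by
    rcases hT.dist_eq_dist_add_one_of_adj r' h with h' | h'
    · obtain ⟨j, -, hj⟩ := hbelow u _ le_rfl (hst u)
      have he := (hj.of_adj hT h.symm h').eq_of_degree_eq_one hT (hdeg i) (hroot i)
      have := hj.dist_le hT
      rw [← he] at this
      omega
    · exact h'
  have hleaf_not_adj (i j : Fin k) : ¬ T.Adj (b i) (b j) := fun h ↦ by
    have h₁ := hadj_leaf j _ h
    have h₂ := hadj_leaf i _ h.symm
    omega
  let X2 (u : V) : ℤ := if T.degree u = 1 then leafReach k (s u) else t u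
  let Y1 (u : V) : ℤ := if T.degree u = 1 then -(D + 1) - leafDrop k (s u) else -T.dist r' u
  let Y2 (u : V) : ℤ := 1 - T.dist r' u
  have hX (u : V) : (s u : ℤ) ≤ X2 u := by
    by_cases hu : T.degree u = 1
    · obtain ⟨i, rfl⟩ := (hleaf u).1 hu
      have := leaf_coordinates hk i.2
      simp only [X2, if_pos hu, hbs]
      omega
    · simpa only [X2, if_neg hu, Nat.cast_le] using hst u
  have hYlow (u : V) : Y1 u ≤ -T.dist r' u := by
    have := hD u
    simp only [Y1]
    split_ifs <;> omega
  have hY (u : V) : Y1 u ≤ Y2 u := by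
    have := hYlow u
    simp only [Y2]
    omega
  let Cross (u v : V) : Prop := (s v : ℤ) ≤ s u ∧ (s u : ℤ) ≤ X2 v ∧ Y1 u ≤ Y1 v ∧ Y1 v ≤ Y2 u
  have hcross_inner (u v : V) (huv : u ≠ v) (hv : T.degree v ≠ 1) :
      Cross u v ↔ T.Adj u v ∧ T.dist r' u = T.dist r' v + 1 := by
    simp only [Cross, X2, if_neg hv, Nat.cast_le]
    constructor
    · rintro ⟨h₁, h₂, h₃, h₄⟩
      obtain ⟨i, hi, hvi⟩ := hbelow v _ h₁ h₂
      have hui : IsAncestor T r' u (b i) := (hspec u i).2 ⟨hi.ge, hi.trans_le (hst u)⟩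
      have hle : T.dist r' v ≤ T.dist r' u := by
        by_cases hu : T.degree u = 1
        · obtain ⟨j, rfl⟩ := (hleaf u).1 hu
          rw [hui.eq_of_degree_eq_one hT hu (hroot j)]
          exact hvi.dist_le hT
        · simp only [Y1, if_neg hu, if_neg hv] at h₃
          omega
      have hne : T.dist r' u ≠ T.dist r' v := fun h ↦ huv (hui.eq_of_dist_eq hT hvi h)
      have hd : T.dist r' u = T.dist r' v + 1 := by
        simp only [Y1, Y2, if_neg hv] at h₄
        omega
      exact ⟨(hvi.adj_of_dist_eq hT hui hd).symm, hd⟩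
    · rintro ⟨hadj, hd⟩
      obtain ⟨i, hi, hui⟩ := hbelow u _ le_rfl (hst u)
      have := (hspec v i).1 (hui.of_adj hT hadj.symm hd)
      have := hYlow u
      simp only [Y2]
      simp only [Y1, if_neg hv] at *
      omega
  have hcross_leaf_inner (u v : V) (hu : T.degree u ≠ 1) (hv : T.degree v = 1) :
      ¬ Cross u v := by
    simp only [Cross, Y1, if_neg hu, if_pos hv]
    have := hD u
    omega
  have hcross_leaf (i j : Fin k) : Cross (b i) (b j) ↔
      leafPos j ≤ leafPos i ∧ leafPos i ≤ leafReach k (leafPos j) ∧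
        leafDrop k (leafPos j) ≤ leafDrop k (leafPos i) := by
    have := hD (b i)
    simp only [Cross, X2, Y1, Y2, hdeg, if_true, hbs]
    omega
  refine ⟨fun u ↦ (s u : ℤ), fun u ↦ X2 u, fun u ↦ Y1 u, fun u ↦ Y2 u,
    fun u ↦ ⟨Int.cast_le.2 (hX u), Int.cast_le.2 (hY u)⟩, fun u v huv ↦ ?_⟩
  have hmeet : (LShape (s u : ℤ) (X2 u) (Y1 u) (Y2 u) ∩
      LShape (s v : ℤ) (X2 v) (Y1 v) (Y2 v)).Nonempty ↔ Cross u v ∨ Cross v u := by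
    rw [LShape_inter_nonempty_iff (Int.cast_le.2 (hX u)) (Int.cast_le.2 (hY u))
      (Int.cast_le.2 (hX v)) (Int.cast_le.2 (hY v))]
    simp only [Int.cast_le, Cross]
  rw [hmeet]
  by_cases hu : T.degree u = 1 <;> by_cases hv : T.degree v = 1
  · obtain ⟨i, rfl⟩ := (hleaf u).1 hu
    obtain ⟨j, rfl⟩ := (hleaf v).1 hv
    have hij : (i : ℕ) ≠ j := fun h ↦ huv (congrArg b (Fin.ext h))
    rw [hcross_leaf, hcross_leaf, leaf_cross_iff hk i.2 j.2 hij]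
    simp only [hleaf_not_adj, false_or, hinj.eq_iff]
    constructor
    · rintro (h | h)
      · exact ⟨i, Or.inl ⟨rfl, Fin.ext h⟩⟩
      · exact ⟨j, Or.inr ⟨rfl, Fin.ext h⟩⟩
    · rintro ⟨l, ⟨rfl, rfl⟩ | ⟨rfl, rfl⟩⟩
      · exact Or.inl rfl
      · exact Or.inr rfl
  · obtain ⟨i, rfl⟩ := (hleaf u).1 hu
    have hne (j : Fin k) : v ≠ b j := by rintro rfl; exact hv (hdeg j)
    simp only [hcross_inner _ _ huv hv, hcross_leaf_inner _ _ hv hu, hne, or_false, and_false,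
      false_and, exists_false]
    exact and_iff_left_of_imp fun h ↦ hadj_leaf i v h.symm
  · obtain ⟨i, rfl⟩ := (hleaf v).1 hv
    have hne (j : Fin k) : u ≠ b j := by rintro rfl; exact hu (hdeg j)
    simp only [hcross_inner _ _ huv.symm hu, hcross_leaf_inner _ _ hu hv, hne, false_or, or_false,
      and_false, false_and, exists_false, T.adj_comm u]
    exact and_iff_left_of_imp fun h ↦ hadj_leaf i u h.symm
  · have hne (j : Fin k) : u ≠ b j := by rintro rfl; exact hu (hdeg j)
    have hne' (j : Fin k) : v ≠ b j := by rintro rfl; exact hv (hdeg j)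
    simp only [hcross_inner _ _ huv hv, hcross_inner _ _ huv.symm hu, hne, hne', or_false,
      and_false, exists_false, T.adj_comm v, ← and_or_left]
    exact and_iff_left_of_imp fun h ↦ hT.dist_eq_dist_add_one_of_adj r' h
end

section
/- Let T be a finite tree rooted at an internal vertex r, whose leaves are enumerated without repetition as a_0, …, a_{k−1} (k ≥ 3). Assume: (i) for every internal vertex u there exist indices 0 ≤ s ≤ t ≤ k−1 with L^r(u) = {a_j : s ≤ j ≤ t}; (ii) r is adjacent to a_0; (iii) the parent a′ of a_{k−1} has degree 2 in T or a′ = r. Let G be the graph on V(T) whose edge set is E(T) together with the edges a_i a_{(i+1) mod k} for 0 ≤ i ≤ k−1. Then there exists an assignment of a C-shape 𝒞_u to each vertex u ∈ V(G) such that for all distinct u, v ∈ V(G): 𝒞_u and 𝒞_v share a segment of nonzero length if and only if uv ∈ E(G). -/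
open SimpleGraph Set Function

/-- The C-shape `𝒞(x₁, x₂, x₃, y₁, y₂) ⊆ ℝ²`. -/
def CShape (x1 x2 x3 y1 y2 : ℝ) : Set (ℝ × ℝ) :=
  {p | p.1 = x1 ∧ y1 ≤ p.2 ∧ p.2 ≤ y2} ∪ {p | p.2 = y1 ∧ x1 ≤ p.1 ∧ p.1 ≤ x2} ∪
    {p | p.2 = y2 ∧ x1 ≤ p.1 ∧ p.1 ≤ x3}

/-- Two subsets of `ℝ²` share a segment of nonzero length. -/
def SharesSeg (A B : Set (ℝ × ℝ)) : Prop :=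
  ∃ p q : ℝ × ℝ, p ≠ q ∧ segment ℝ p q ⊆ A ∩ B

/-- Two axis-parallel segments on the parallel lines with offsets `c` and `c'`, spanning
`[s, e]` and `[s', e']`, overlap in a segment of nonzero length. -/
def Overlap {R : Type*} [LinearOrder R] (c s e c' s' e' : R) : Prop :=
  c = c' ∧ max s s' < min e e'

/-- Integer parameters of C-shapes representing a rooted tree with parent map `par` together with a
cycle through its leaves, given a numbering `f` that increases away from the root and runs through
the leaves, consecutively and last, from the child `a0` of the root `r` to `al`. A vertex `u` is
drawn with its vertical side on the line `x = 2 * f u`, a short lower arm meeting the upper arm of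
its parent and a long upper arm at height `2 * f u`. The upper arms of the leaves chain up at
height `M`; the cycle is closed at height `-2`. -/
theorem exists_overlap_representation {V : Type*} (f : V → ℤ) (par : V → V)
    (Leaf : V → Prop) (r a0 al a' : V) (M : ℤ) (hf : Injective f)
    (hpar : ∀ u, u ≠ r → ¬ Leaf (par u) ∧ f (par u) < f u)
    (hr0 : 0 ≤ f r) (hr : ∀ u, u ≠ r → f r < f u) (hlr : ¬ Leaf r) (hla' : ¬ Leaf a')
    (hla0 : Leaf a0) (hlal : Leaf al) (hlf : ∀ u v, Leaf u → ¬ Leaf v → f v < f u)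
    (hpa0 : par a0 = r) (hpal : par al = a') (hle : ∀ u, Leaf u → f a0 ≤ f u ∧ f u ≤ f al)
    (h2 : f a0 + 2 ≤ f al) (ha' : a' = r ∨ ∀ u, u ≠ r → par u = a' → u = al)
    (hM : ∀ u, 2 * f u + 4 < M) :
    ∃ x1 x2 x3 y1 y2 : V → ℤ,
      (∀ u : V, x1 u ≤ x2 u ∧ x1 u ≤ x3 u ∧ y1 u ≤ y2 u) ∧
      ∀ u v : V, u ≠ v →
        ((Overlap (x1 u) (y1 u) (y2 u) (x1 v) (y1 v) (y2 v) ∨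
          Overlap (y1 u) (x1 u) (x2 u) (y1 v) (x1 v) (x2 v) ∨
          Overlap (y1 u) (x1 u) (x2 u) (y2 v) (x1 v) (x3 v) ∨
          Overlap (y2 u) (x1 u) (x3 u) (y1 v) (x1 v) (x2 v) ∨
          Overlap (y2 u) (x1 u) (x3 u) (y2 v) (x1 v) (x3 v)) ↔
          ((u ≠ r ∧ par u = v ∨ v ≠ r ∧ par v = u) ∨
            (Leaf u ∧ Leaf v ∧ (f v = f u + 1 ∨ f u = f v + 1 ∨
              (u = a0 ∧ v = al) ∨ (u = al ∧ v = a0))))) := by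
  classical
  let x1 : V → ℤ := fun u =>
    if u = a0 then 2 * f r else if u = a' ∧ a' ≠ r then 2 * f al else 2 * f u
  let x2 : V → ℤ := fun u =>
    if u = a0 ∨ u = al then M else if u = r then (if a' = r then M else 2 * f r) else x1 u + 1
  let x3 : V → ℤ := fun u =>
    if Leaf u then 2 * f u + 3 else if u = a' ∧ a' ≠ r then 2 * f al else M
  let y1 : V → ℤ := fun u =>
    if u = a0 ∨ u = al then -2 else if u = r then (if a' = r then -2 else -1) else 2 * f (par u)
  let y2 : V → ℤ := fun u =>
    if Leaf u then M else if u = a' ∧ a' ≠ r then 2 * f (par u) + 1 else 2 * f u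
  have hcase : ∀ u,
      (u = a0 ∧ Leaf u ∧ u ≠ r ∧ x1 u = 2 * f r ∧ x2 u = M ∧ x3 u = 2 * f u + 3 ∧
        y1 u = -2 ∧ y2 u = M) ∨
      (u = al ∧ Leaf u ∧ u ≠ r ∧ x1 u = 2 * f u ∧ x2 u = M ∧ x3 u = 2 * f u + 3 ∧
        y1 u = -2 ∧ y2 u = M) ∨
      (u ≠ a0 ∧ u ≠ al ∧ Leaf u ∧ u ≠ r ∧ x1 u = 2 * f u ∧ x2 u = 2 * f u + 1 ∧
        x3 u = 2 * f u + 3 ∧ y1 u = 2 * f (par u) ∧ y2 u = M) ∨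
      (u = r ∧ ¬ Leaf u ∧ a' = r ∧ x1 u = 2 * f u ∧ x2 u = M ∧ x3 u = M ∧
        y1 u = -2 ∧ y2 u = 2 * f u) ∨
      (u = r ∧ ¬ Leaf u ∧ a' ≠ r ∧ x1 u = 2 * f u ∧ x2 u = 2 * f u ∧ x3 u = M ∧
        y1 u = -1 ∧ y2 u = 2 * f u) ∨
      (u = a' ∧ u ≠ r ∧ ¬ Leaf u ∧ x1 u = 2 * f al ∧ x2 u = 2 * f al + 1 ∧ x3 u = 2 * f al ∧
        y1 u = 2 * f (par u) ∧ y2 u = 2 * f (par u) + 1) ∨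
      (u ≠ a' ∧ u ≠ r ∧ ¬ Leaf u ∧ x1 u = 2 * f u ∧ x2 u = 2 * f u + 1 ∧ x3 u = M ∧
        y1 u = 2 * f (par u) ∧ y2 u = 2 * f u) := by
    intro u
    have h0l : a0 ≠ al := by rintro rfl; omega
    have hlne : ∀ {v w}, Leaf v → ¬ Leaf w → v ≠ w := fun hv hw h => hw (h ▸ hv)
    have h0r := hlne hla0 hlr
    have hlr' := hlne hlal hlr
    by_cases h0 : u = a0
    · subst h0
      exact Or.inl (by simp [x1, x2, x3, y1, y2, hla0, h0r])
    by_cases h1 : u = al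
    · subst h1
      exact Or.inr (Or.inl (by simp [x1, x2, x3, y1, y2, hlal, hlr', h0, hlne hlal hla']))
    by_cases hL : Leaf u
    · exact Or.inr (Or.inr (Or.inl (by
        simp [x1, x2, x3, y1, y2, hL, hlne hL hlr, h0, h1, hlne hL hla'])))
    by_cases hur : u = r
    · subst hur
      by_cases har : a' = u
      · exact Or.inr (Or.inr (Or.inr (Or.inl (by simp [x1, x2, x3, y1, y2, hL, h0, h1, har]))))
      · exact Or.inr (Or.inr (Or.inr (Or.inr (Or.inl (by
          simp [x1, x2, x3, y1, y2, hL, h0, h1, har, Ne.symm har])))))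
    by_cases hua : u = a'
    · subst hua
      exact Or.inr (Or.inr (Or.inr (Or.inr (Or.inr (Or.inl (by
        simp [x1, x2, x3, y1, y2, hL, h0, h1, hur]))))))
    · exact Or.inr (Or.inr (Or.inr (Or.inr (Or.inr (Or.inr (by
        simp [x1, x2, x3, y1, y2, hL, h0, h1, hur, hua]))))))
  clear_value x1 x2 x3 y1 y2
  refine ⟨x1, x2, x3, y1, y2, ?_, ?_⟩
  · intro u
    have h1 := hcase u
    have := hM u
    have := hM al
    have := hM r
    have := hpar u
    grind
  · intro u v huv
    have hu := hcase u
    have hv := hcase v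
    have hMu := hM u
    have hMv := hM v
    have hMl := hM al
    have hMr := hM r
    have hpu := hpar u
    have hpv := hpar v
    have hfuv : f u ≠ f v := fun h => huv (hf h)
    have hfu : f (par u) = f v ↔ par u = v := hf.eq_iff
    have hfv : f (par v) = f u ↔ par v = u := hf.eq_iff
    have hle_f : ∀ w, f r ≤ f w := fun w => by
      rcases eq_or_ne w r with rfl | h
      · rfl
      · exact (hr w h).le
    have := hle_f (par u)
    have := hle_f (par v)
    have hru := hr u
    have hrv := hr v
    have := hlf u v
    have := hlf v u
    have := hlf u (par u)
    have := hlf v (par v)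
    have := hlf u (par v)
    have := hlf v (par u)
    have := hlf al u
    have := hlf al v
    have := hle u
    have := hle v
    have ful : f u = f al ↔ u = al := hf.eq_iff
    have fvl : f v = f al ↔ v = al := hf.eq_iff
    have fu0 : f u = f a0 ↔ u = a0 := hf.eq_iff
    have fv0 : f v = f a0 ↔ v = a0 := hf.eq_iff
    have : a' = r ∨ (u ≠ r → par u = a' → u = al) := ha'.imp_right (fun h => h u)
    have : a' = r ∨ (v ≠ r → par v = a' → v = al) := ha'.imp_right (fun h => h v)
    clear hcase hM hpar hr hlf hle ha' hf hle_f
    unfold Overlap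
    simp only [max_lt_iff, lt_min_iff]
    rcases hu with hu | hu | hu | hu | hu | hu | hu <;>
    rcases hv with hv | hv | hv | hv | hv | hv | hv <;> grind (splits := 40)

theorem Overlap.cast_iff {c s e c' s' e' : ℤ} :
    Overlap (c : ℝ) s e c' s' e' ↔ Overlap c s e c' s' e' := by
  unfold Overlap
  norm_cast

theorem segment_infinite {p q : ℝ × ℝ} (h : p ≠ q) : (segment ℝ p q).Infinite := by
  rw [segment_eq_image_lineMap]
  exact (Set.Icc_infinite zero_lt_one).image (AffineMap.lineMap_injective ℝ h).injOn

theorem vertical_inter_subsingleton {c s e c' s' e' : ℝ} (h : ¬ Overlap c s e c' s' e') :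
    ({p : ℝ × ℝ | p.1 = c ∧ s ≤ p.2 ∧ p.2 ≤ e} ∩
      {p | p.1 = c' ∧ s' ≤ p.2 ∧ p.2 ≤ e'}).Subsingleton := by
  rintro ⟨x, y⟩ ⟨⟨h1, h2, h3⟩, h4, h5, h6⟩ ⟨x', y'⟩ ⟨⟨h1', h2', h3'⟩, h4', h5', h6'⟩
  simp only [Overlap, max_lt_iff, lt_min_iff] at *
  subst h1 h1'
  refine Prod.ext rfl (le_antisymm ?_ ?_) <;> dsimp only <;> by_contra! hlt <;>
    exact h ⟨h4, ⟨by linarith, by linarith⟩, by linarith, by linarith⟩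

theorem horizontal_inter_subsingleton {c s e c' s' e' : ℝ} (h : ¬ Overlap c s e c' s' e') :
    ({p : ℝ × ℝ | p.2 = c ∧ s ≤ p.1 ∧ p.1 ≤ e} ∩
      {p | p.2 = c' ∧ s' ≤ p.1 ∧ p.1 ≤ e'}).Subsingleton := by
  intro p hp q hq
  exact Prod.swap_injective <| vertical_inter_subsingleton h
    (by simpa using hp) (by simpa using hq)

theorem vertical_inter_horizontal_subsingleton (c s e c' s' e' : ℝ) :
    ({p : ℝ × ℝ | p.1 = c ∧ s ≤ p.2 ∧ p.2 ≤ e} ∩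
      {p | p.2 = c' ∧ s' ≤ p.1 ∧ p.1 ≤ e'}).Subsingleton :=
  fun _ hp _ hq => Prod.ext (hp.1.1.trans hq.1.1.symm) (hp.2.1.trans hq.2.1.symm)

theorem sharesSeg_of_vertical_overlap {A B : Set (ℝ × ℝ)} {c s e c' s' e' : ℝ}
    (hA : {p : ℝ × ℝ | p.1 = c ∧ s ≤ p.2 ∧ p.2 ≤ e} ⊆ A)
    (hB : {p : ℝ × ℝ | p.1 = c' ∧ s' ≤ p.2 ∧ p.2 ≤ e'} ⊆ B)
    (h : Overlap c s e c' s' e') : SharesSeg A B := by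
  obtain ⟨rfl, h⟩ := h
  refine ⟨(c, max s s'), (c, min e e'), by simpa using h.ne, ?_⟩
  rw [← Prod.image_mk_segment_right, segment_eq_Icc h.le]
  rintro _ ⟨y, ⟨hy1, hy2⟩, rfl⟩
  rw [max_le_iff] at hy1
  rw [le_min_iff] at hy2
  exact ⟨hA ⟨rfl, hy1.1, hy2.1⟩, hB ⟨rfl, hy1.2, hy2.2⟩⟩

theorem sharesSeg_of_horizontal_overlap {A B : Set (ℝ × ℝ)} {c s e c' s' e' : ℝ}
    (hA : {p : ℝ × ℝ | p.2 = c ∧ s ≤ p.1 ∧ p.1 ≤ e} ⊆ A)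
    (hB : {p : ℝ × ℝ | p.2 = c' ∧ s' ≤ p.1 ∧ p.1 ≤ e'} ⊆ B)
    (h : Overlap c s e c' s' e') : SharesSeg A B := by
  obtain ⟨rfl, h⟩ := h
  refine ⟨(max s s', c), (min e e', c), by simpa using h.ne, ?_⟩
  rw [← Prod.image_mk_segment_left, segment_eq_Icc h.le]
  rintro _ ⟨y, ⟨hy1, hy2⟩, rfl⟩
  rw [max_le_iff] at hy1
  rw [le_min_iff] at hy2
  exact ⟨hA ⟨rfl, hy1.1, hy2.1⟩, hB ⟨rfl, hy1.2, hy2.2⟩⟩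

theorem sharesSeg_cShape_iff (x1 x2 x3 y1 y2 x1' x2' x3' y1' y2' : ℝ) :
    SharesSeg (CShape x1 x2 x3 y1 y2) (CShape x1' x2' x3' y1' y2') ↔
      Overlap x1 y1 y2 x1' y1' y2' ∨ Overlap y1 x1 x2 y1' x1' x2' ∨
        Overlap y1 x1 x2 y2' x1' x3' ∨ Overlap y2 x1 x3 y1' x1' x2' ∨
        Overlap y2 x1 x3 y2' x1' x3' := by
  constructor
  · rintro ⟨p, q, hpq, hsub⟩
    by_contra! hno
    obtain ⟨h1, h2, h3, h4, h5⟩ := hno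
    refine segment_infinite hpq (Set.Finite.subset ?_ hsub)
    have hvh := fun c s e c' s' e' => (vertical_inter_horizontal_subsingleton c s e c' s' e').finite
    have hhv := fun c s e c' s' e' => (hvh c s e c' s' e').subset (inter_comm _ _).subset
    simp only [CShape, union_inter_distrib_right, inter_union_distrib_left, finite_union]
    exact ⟨⟨⟨⟨(vertical_inter_subsingleton h1).finite, hhv ..⟩, hhv ..⟩,
      ⟨hvh .., (horizontal_inter_subsingleton h2).finite⟩,
        (horizontal_inter_subsingleton h4).finite⟩,
      ⟨hvh .., (horizontal_inter_subsingleton h3).finite⟩,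
        (horizontal_inter_subsingleton h5).finite⟩
  · have hV : ∀ {x1 x2 x3 y1 y2 : ℝ}, {p : ℝ × ℝ | p.1 = x1 ∧ y1 ≤ p.2 ∧ p.2 ≤ y2} ⊆
        CShape x1 x2 x3 y1 y2 := by intro _ _ _ _ _ p hp; exact Or.inl (Or.inl hp)
    have hB : ∀ {x1 x2 x3 y1 y2 : ℝ}, {p : ℝ × ℝ | p.2 = y1 ∧ x1 ≤ p.1 ∧ p.1 ≤ x2} ⊆
        CShape x1 x2 x3 y1 y2 := by intro _ _ _ _ _ p hp; exact Or.inl (Or.inr hp)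
    have hT : ∀ {x1 x2 x3 y1 y2 : ℝ}, {p : ℝ × ℝ | p.2 = y2 ∧ x1 ≤ p.1 ∧ p.1 ≤ x3} ⊆
        CShape x1 x2 x3 y1 y2 := by intro _ _ _ _ _ p hp; exact Or.inr hp
    rintro (h | h | h | h | h)
    · exact sharesSeg_of_vertical_overlap hV hV h
    · exact sharesSeg_of_horizontal_overlap hB hB h
    · exact sharesSeg_of_horizontal_overlap hB hT h
    · exact sharesSeg_of_horizontal_overlap hT hB h
    · exact sharesSeg_of_horizontal_overlap hT hT h

theorem SimpleGraph.IsTree.exists_parent {V : Type*} {T : SimpleGraph V} (hT : T.IsTree) (r : V) :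
    ∃ par : V → V, (∀ u, u ≠ r → T.dist r u = T.dist r (par u) + 1) ∧
      ∀ u v, T.Adj u v ↔ u ≠ r ∧ par u = v ∨ v ≠ r ∧ par v = u := by
  have key : ∀ u, ∃ w, u ≠ r → T.Adj w u ∧ T.dist r u = T.dist r w + 1 := by
    intro u
    obtain ⟨p, hp⟩ := hT.connected.exists_walk_length_eq_dist r u
    refine ⟨p.penultimate, fun hu => ?_⟩
    have hnil : ¬ p.Nil := fun h => hu h.eq.symm
    have hadj := p.adj_penultimate hnil
    have hle : T.dist r p.penultimate ≤ p.length - 1 := by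
      simpa using dist_le p.dropLast
    have := hT.dist_eq_dist_add_one_of_adj r hadj
    exact ⟨hadj, by omega⟩
  choose par hpar using key
  have huniq : ∀ u v, T.Adj u v → T.dist r u = T.dist r v + 1 → par u = v := by
    intro u v huv hd
    have hu : u ≠ r := by rintro rfl; simp at hd
    obtain ⟨p, hp⟩ := hT.connected.exists_walk_length_eq_dist r v
    obtain ⟨q, hq⟩ := hT.connected.exists_walk_length_eq_dist r (par u)
    have hpath : ∀ w (s : T.Walk r w) (h : T.Adj w u), s.length = T.dist r w →
        T.dist r u = T.dist r w + 1 → (s.concat h).IsPath := fun w s h hs hd' =>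
      (s.concat h).isPath_of_length_eq_dist (by rw [Walk.length_concat, hs, hd'])
    have heq := (hT.existsUnique_path r u).unique (hpath _ p huv.symm hp hd)
      (hpath _ q (hpar u hu).1 hq (hpar u hu).2)
    simpa using (congrArg Walk.penultimate heq).symm
  refine ⟨par, fun u hu => (hpar u hu).2, fun u v => ⟨fun h => ?_, ?_⟩⟩
  · rcases hT.dist_eq_dist_add_one_of_adj r h with hd | hd
    · exact Or.inl ⟨by rintro rfl; simp at hd, huniq u v h hd⟩
    · exact Or.inr ⟨by rintro rfl; simp at hd, huniq v u h.symm hd⟩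
  · rintro (⟨hu, rfl⟩ | ⟨hv, rfl⟩)
    · exact (hpar u hu).1.symm
    · exact (hpar v hv).1

/-- A numbering of the vertices that is compatible with depth and enumerates the leaves last. -/
theorem exists_numbering {V : Type*} [Fintype V] (depth : V → ℕ) {k : ℕ} (a : Fin k → V)
    (hinj : Injective a) :
    ∃ (f : V → ℤ) (B : ℤ), Injective f ∧ (∀ u, 0 ≤ f u) ∧ (∀ i, f (a i) = B + (i : ℕ)) ∧
      (∀ u, (∀ i, u ≠ a i) → f u < B) ∧
      ∀ u v, (∀ i, u ≠ a i) → depth u < depth v → f u < f v := by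
  classical
  obtain ⟨e, he⟩ : ∃ e : V → ℕ, Injective e :=
    ⟨fun v => Fintype.equivFin V v, Fin.val_injective.comp (Fintype.equivFin V).injective⟩
  obtain ⟨n, hn⟩ : ∃ n, ∀ v, e v < n :=
    ⟨Finset.univ.sup e + 1, fun v => Nat.lt_succ_of_le (Finset.le_sup (Finset.mem_univ v))⟩
  obtain ⟨g, hg⟩ : ∃ g : V → ℕ, ∀ v, g v = depth v * n + e v := ⟨_, fun _ => rfl⟩
  have hlt : ∀ u v, depth u < depth v → g u < g v := by
    intro u v h
    rw [hg, hg]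
    have := hn u
    nlinarith [Nat.mul_le_mul_right n h]
  have hginj : Injective g := by
    intro u v h
    have hd : depth u = depth v := by
      rcases lt_trichotomy (depth u) (depth v) with h' | h' | h'
      · exact absurd h (hlt _ _ h').ne
      · exact h'
      · exact absurd h (hlt _ _ h').ne'
    rw [hg, hg, hd] at h
    exact he (Nat.add_left_cancel h)
  obtain ⟨B, hB⟩ : ∃ B, ∀ v, g v < B :=
    ⟨Finset.univ.sup g + 1, fun v => Nat.lt_succ_of_le (Finset.le_sup (Finset.mem_univ v))⟩
  obtain ⟨f, hfa, hfn⟩ : ∃ f : V → ℤ, (∀ i, f (a i) = B + (i : ℕ)) ∧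
      ∀ u, (∀ i, u ≠ a i) → f u = g u := by
    refine ⟨fun u => if h : ∃ i, a i = u then B + (h.choose : ℕ) else g u, fun i => ?_,
      fun u hu => ?_⟩
    · have h : ∃ j, a j = a i := ⟨i, rfl⟩
      have := hinj h.choose_spec
      simp only [h, dif_pos, this]
    · have h : ¬ ∃ i, a i = u := fun ⟨i, hi⟩ => hu i hi.symm
      simp only [h, dif_neg, not_false_eq_true]
  have hcases : ∀ u, (∃ i, u = a i) ∨ ∀ i, u ≠ a i := fun u => by
    by_cases h : ∃ i, u = a i
    · exact Or.inl h
    · exact Or.inr (not_exists.mp h)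
  refine ⟨f, B, ?_, ?_, hfa, ?_, ?_⟩
  · intro u v h
    rcases hcases u with ⟨i, rfl⟩ | hu <;> rcases hcases v with ⟨j, rfl⟩ | hv
    · rw [hfa, hfa] at h
      exact congrArg a (Fin.ext (by omega))
    · have := hB v
      rw [hfa, hfn v hv] at h
      omega
    · have := hB u
      rw [hfa, hfn u hu] at h
      omega
    · rw [hfn u hu, hfn v hv] at h
      exact hginj (by exact_mod_cast h)
  · intro u
    rcases hcases u with ⟨i, rfl⟩ | hu
    · rw [hfa]; positivity
    · rw [hfn u hu]; positivity
  · intro u hu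
    rw [hfn u hu]
    exact_mod_cast hB u
  · intro u v hu h
    rw [hfn u hu]
    rcases hcases v with ⟨i, rfl⟩ | hv
    · have := hB u
      rw [hfa]; omega
    · rw [hfn v hv]
      exact_mod_cast hlt u v h

/-- Under the stated hypotheses on the tree `T` rooted at `r` with leaves
`a_0, …, a_{k−1}`, the graph `G` obtained from `T` by adding the leaf cycle has a
B₂-EPG representation by C-shapes. -/
theorem stmt13 {V : Type*} [Fintype V] (T : SimpleGraph V) [DecidableRel T.Adj]
    (hT : T.IsTree) {k : ℕ} (hk : 3 ≤ k) (a : Fin k → V)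
    (hinj : Function.Injective a)
    (hleaf : ∀ v : V, T.degree v = 1 ↔ ∃ i : Fin k, v = a i)
    (r : V) (hr : 2 ≤ T.degree r)
    (hconsec : ∀ u : V, 2 ≤ T.degree u → ∃ s t : Fin k, s ≤ t ∧
        LeafSet T r u = {x | ∃ j : Fin k, s ≤ j ∧ j ≤ t ∧ x = a j})
    (hra0 : T.Adj r (a ⟨0, by omega⟩))
    (a' : V) (ha' : IsParent T r a' (a ⟨k - 1, by omega⟩))
    (ha'deg : T.degree a' = 2 ∨ a' = r) :
    ∃ x1 x2 x3 y1 y2 : V → ℝ,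
      (∀ u : V, x1 u ≤ x2 u ∧ x1 u ≤ x3 u ∧ y1 u ≤ y2 u) ∧
      ∀ u v : V, u ≠ v →
        (SharesSeg (CShape (x1 u) (x2 u) (x3 u) (y1 u) (y2 u))
            (CShape (x1 v) (x2 v) (x3 v) (y1 v) (y2 v)) ↔
          (T.Adj u v ∨ ∃ i : Fin k,
            (u = a i ∧ v = a (cidx (by omega) ((i : ℕ) + 1))) ∨
            (v = a i ∧ u = a (cidx (by omega) ((i : ℕ) + 1))))) := by
  classical
  obtain ⟨par, hdist, hadj⟩ := hT.exists_parent r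
  obtain ⟨f, B, hf, hf0, hfa, hfB, hfd⟩ := exists_numbering (T.dist r) a hinj
  set a0 := a ⟨0, by omega⟩ with ha0
  set al := a ⟨k - 1, by omega⟩ with hal
  have hleaf' : ∀ u, (∀ i, u ≠ a i) ↔ T.degree u ≠ 1 := fun u => by
    rw [ne_eq, hleaf, not_exists]
  have hrn : T.degree r ≠ 1 := by omega
  have huniq : ∀ u v w, T.degree u = 1 → T.Adj u v → T.Adj u w → v = w := by
    intro u v w hu hv hw
    exact (degree_eq_one_iff_existsUnique_adj.mp hu).unique hv hw
  have hparadj : ∀ u, u ≠ r → T.Adj u (par u) := fun u hu => (hadj u _).2 (Or.inl ⟨hu, rfl⟩)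
  have hparn : ∀ u, u ≠ r → T.degree (par u) ≠ 1 := by
    intro u hu h1
    have hpr : par u ≠ r := fun h => hrn (h ▸ h1)
    have h2 := huniq _ _ _ h1 (hparadj u hu).symm (hparadj _ hpr)
    have h3 := hdist u hu
    have h4 := hdist _ hpr
    rw [← h2] at h4
    omega
  have hla0 : T.degree a0 = 1 := (hleaf _).2 ⟨_, rfl⟩
  have hlal : T.degree al = 1 := (hleaf _).2 ⟨_, rfl⟩
  have hner : ∀ u, T.degree u = 1 → u ≠ r := fun u hu h => hrn (h ▸ hu)
  have hpa0 : par a0 = r := huniq _ _ _ hla0 (hparadj _ (hner _ hla0)) hra0.symm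
  have hpal : par al = a' := huniq _ _ _ hlal (hparadj _ (hner _ hlal)) ha'.2.2.symm
  have hla' : T.degree a' ≠ 1 := hpal ▸ hparn al (hner _ hlal)
  obtain ⟨M, hM⟩ : ∃ M : ℤ, ∀ u, 2 * f u + 4 < M := by
    obtain ⟨N, hN⟩ := (Set.finite_range f).bddAbove
    exact ⟨2 * N + 5, fun u => by have := hN ⟨u, rfl⟩; omega⟩
  have hchild : a' = r ∨ ∀ u, u ≠ r → par u = a' → u = al := by
    by_cases har : a' = r
    · exact Or.inl har
    refine Or.inr fun u hu hua => ?_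
    by_contra hne
    have hdeg : T.degree a' = 2 := ha'deg.resolve_right har
    have hd1 := hdist a' har
    have hd2 := hdist u hu
    have hd3 := hdist al (hner _ hlal)
    rw [hua] at hd2
    rw [hpal] at hd3
    have hsub : ({u, al, par a'} : Finset V) ⊆ T.neighborFinset a' := by
      intro w hw
      rw [mem_neighborFinset]
      simp only [Finset.mem_insert, Finset.mem_singleton] at hw
      rcases hw with rfl | rfl | rfl
      · exact hua ▸ (hparadj _ hu).symm
      · exact ha'.2.2
      · exact hparadj _ har
    have hcard := Finset.card_le_card hsub
    rw [card_neighborFinset_eq_degree, hdeg, Finset.card_eq_three.2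
      ⟨u, al, par a', hne, by rintro rfl; omega, by intro h; rw [h] at hd3; omega, rfl⟩] at hcard
    omega
  obtain ⟨x1, x2, x3, y1, y2, hval, hov⟩ := exists_overlap_representation f par
    (fun u => T.degree u = 1) r a0 al a' M hf
    (fun u hu => ⟨hparn u hu, hfd _ _ ((hleaf' _).2 (hparn u hu)) (by rw [hdist u hu]; omega)⟩)
    (hf0 r) (fun u hu => hfd _ _ ((hleaf' _).2 hrn)
      (by rw [dist_self]; exact hT.connected.pos_dist_of_ne hu.symm))
    hrn hla' hla0 hlal
    (fun u v hu hv => by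
      obtain ⟨i, rfl⟩ := (hleaf u).1 hu
      have := hfB v ((hleaf' _).2 hv)
      rw [hfa]; omega)
    hpa0 hpal
    (fun u hu => by
      obtain ⟨i, rfl⟩ := (hleaf u).1 hu
      rw [ha0, hal, hfa, hfa, hfa]
      dsimp only
      omega)
    (by rw [ha0, hal, hfa, hfa]; dsimp only; omega)
    hchild hM
  refine ⟨fun u => x1 u, fun u => x2 u, fun u => x3 u, fun u => y1 u, fun u => y2 u,
    fun u => by simpa using hval u, fun u v huv => ?_⟩
  simp only [sharesSeg_cShape_iff, Overlap.cast_iff]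
  rw [hov u v huv, ← hadj]
  refine or_congr_right ?_
  have hcyc : ∀ i j : Fin k, j = cidx (by omega) ((i : ℕ) + 1) ↔
      (j : ℕ) = i + 1 ∨ ((i : ℕ) = k - 1 ∧ (j : ℕ) = 0) := by
    intro i j
    rw [Fin.ext_iff, cidx]
    dsimp only
    rcases eq_or_ne (i : ℕ) (k - 1) with h | h
    · rw [h, Nat.sub_add_cancel (by omega), Nat.mod_self]
      omega
    · rw [Nat.mod_eq_of_lt (by omega)]
      omega
  constructor
  · rintro ⟨hu, hv, h⟩
    obtain ⟨i, rfl⟩ := (hleaf u).1 hu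
    obtain ⟨j, rfl⟩ := (hleaf v).1 hv
    have hcases : j = cidx (by omega) ((i : ℕ) + 1) ∨ i = cidx (by omega) ((j : ℕ) + 1) := by
      rw [hcyc, hcyc]
      rw [hfa, hfa, ha0, hal, hinj.eq_iff, hinj.eq_iff, hinj.eq_iff, hinj.eq_iff] at h
      simp only [Fin.ext_iff] at h
      omega
    rcases hcases with h | h
    · exact ⟨i, Or.inl ⟨rfl, congrArg a h⟩⟩
    · exact ⟨j, Or.inr ⟨rfl, congrArg a h⟩⟩
  · have hfwd : ∀ i j : Fin k, j = cidx (by omega) ((i : ℕ) + 1) →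
        f (a j) = f (a i) + 1 ∨ (a i = al ∧ a j = a0) := by
      intro i j hij
      rw [hfa, hfa, ha0, hal, hinj.eq_iff, hinj.eq_iff]
      simp only [Fin.ext_iff]
      have := (hcyc i j).1 hij
      omega
    rintro ⟨i, ⟨rfl, rfl⟩ | ⟨rfl, rfl⟩⟩ <;>
      refine ⟨(hleaf _).2 ⟨_, rfl⟩, (hleaf _).2 ⟨_, rfl⟩, ?_⟩ <;>
      have := hfwd i _ rfl <;> tauto
end
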